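/- arXiv:2301.06157 — 7 statements merged into one kernel-verified Lean document; each statement's English description precedes it below -/
import Mathlib

section
/- There exist an LTL game G, a strategy profile σ in the core of G, and a fulfilled coalition C ⊆ Ag such that C is not a subset of Winners(ρ(σ)). -/
/-- A concurrent game structure over a set of agents `Ag`, states `St`, and,
for each agent `i`, a set of actions `Ac i`.  It consists of an initial state
and a transition function. -/
structure CGS (Ag St : Type) (Ac : Ag → Type) where
  init : St
  tr : St → (∀ i, Ac i) → St

/-- A strategy for a player with actions `A`: it maps finite (nonempty)
histories of states, given as lists, to an action. -/
abbrev Strategy (St A : Type) := List St → A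

/-- A strategy profile: one strategy for each player. -/
abbrev Profile {Ag : Type} (St : Type) (Ac : Ag → Type) := ∀ i, Strategy St (Ac i)

namespace CGS

variable {Ag St : Type} {Ac : Ag → Type}

/-- The history `ρ(σ)[0 … t]` (as a list) together with the current state
`ρ(σ)[t]` of the run induced by a strategy profile `σ`. -/
def histRun (M : CGS Ag St Ac) (σ : Profile St Ac) : ℕ → List St × St
  | 0 => ([M.init], M.init)
  | t + 1 =>
      let p := histRun M σ t
      let s := M.tr p.2 (fun i => σ i p.1)
      (p.1 ++ [s], s)

/-- The unique run `ρ(σ)` induced by a strategy profile `σ`. -/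
def run (M : CGS Ag St Ac) (σ : Profile St Ac) (t : ℕ) : St :=
  (histRun M σ t).2

/-- A run of `M`: an infinite state sequence starting at the initial state in
which every step is obtained by some action profile. -/
def IsRun (M : CGS Ag St Ac) (ρ : ℕ → St) : Prop :=
  ρ 0 = M.init ∧ ∀ t, ∃ a : ∀ i, Ac i, ρ (t + 1) = M.tr (ρ t) a

end CGS

open Classical in
/-- Combine a joint strategy `σC` for a coalition `C` with strategies `σN`
for the players outside `C`, obtaining a full strategy profile. -/
noncomputable def combine {Ag St : Type} {Ac : Ag → Type} (C : Set Ag)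
    (σC : ∀ i ∈ C, Strategy St (Ac i)) (σN : ∀ i ∉ C, Strategy St (Ac i)) :
    Profile St Ac :=
  fun i => if h : i ∈ C then σC i h else σN i h

/-- Syntax of Linear Temporal Logic over atomic propositions `AP`:
atoms, negation, disjunction, next, and until. -/
inductive LTLFormula (AP : Type) where
  | atom : AP → LTLFormula AP
  | neg  : LTLFormula AP → LTLFormula AP
  | disj : LTLFormula AP → LTLFormula AP → LTLFormula AP
  | next : LTLFormula AP → LTLFormula AP
  | untl : LTLFormula AP → LTLFormula AP → LTLFormula AP

/-- Standard LTL semantics over infinite runs `ρ : ℕ → St`, via a labelling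
function `lab : St → Set AP`. -/
def LTLFormula.Sat {AP St : Type} (lab : St → Set AP) :
    LTLFormula AP → (ℕ → St) → Prop
  | .atom p, ρ => p ∈ lab (ρ 0)
  | .neg φ, ρ => ¬ LTLFormula.Sat lab φ ρ
  | .disj φ ψ, ρ => LTLFormula.Sat lab φ ρ ∨ LTLFormula.Sat lab ψ ρ
  | .next φ, ρ => LTLFormula.Sat lab φ (fun t => ρ (t + 1))
  | .untl φ ψ, ρ =>
      ∃ j : ℕ, LTLFormula.Sat lab ψ (fun t => ρ (t + j)) ∧
        ∀ k < j, LTLFormula.Sat lab φ (fun t => ρ (t + k))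

/-- An LTL game: a concurrent game structure together with a labelling
function and an LTL goal for each player. -/
structure LTLGame (Ag St : Type) (Ac : Ag → Type) (AP : Type) where
  M : CGS Ag St Ac
  lab : St → Set AP
  goal : Ag → LTLFormula AP

namespace LTLGame

variable {Ag St AP : Type} {Ac : Ag → Type}

/-- The winners of a run: players whose goal is satisfied by the run. -/
def winners (G : LTLGame Ag St Ac AP) (ρ : ℕ → St) : Set Ag :=
  {i | (G.goal i).Sat G.lab ρ}

/-- `σC` is a beneficial deviation for the (nonempty) coalition `C` from the
strategy profile `σ`: every member of `C` loses under `σ`, and all members of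
`C` win under `(σC, σN)` no matter which joint strategy `σN` the remaining
players use. -/
def BeneficialDeviation (G : LTLGame Ag St Ac AP) (C : Set Ag)
    (σ : Profile St Ac) (σC : ∀ i ∈ C, Strategy St (Ac i)) : Prop :=
  C.Nonempty ∧
  C ⊆ (G.winners (G.M.run σ))ᶜ ∧
  ∀ σN : ∀ i ∉ C, Strategy St (Ac i), C ⊆ G.winners (G.M.run (combine C σC σN))

/-- A strategy profile is in the core iff no coalition has a beneficial
deviation from it. -/
def inCore (G : LTLGame Ag St Ac AP) (σ : Profile St Ac) : Prop :=
  ∀ (C : Set Ag) (σC : ∀ i ∈ C, Strategy St (Ac i)),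
    ¬ G.BeneficialDeviation C σ σC

/-- A (nonempty) coalition `C` is fulfilled if it has a joint strategy
guaranteeing all goals of its members, against every joint strategy of the
remaining players. -/
def Fulfilled (G : LTLGame Ag St Ac AP) (C : Set Ag) : Prop :=
  C.Nonempty ∧
  ∃ σC : ∀ i ∈ C, Strategy St (Ac i),
    ∀ σN : ∀ i ∉ C, Strategy St (Ac i),
      C ⊆ G.winners (G.M.run (combine C σC σN))

/-- `σC` is a strong beneficial deviation for the (nonempty) coalition `C`
from `σ`: (1) all members of `C` lose under `σ`; (2) all members of `C` win
under `(σ₋C, σC)`; (3) against every counter joint strategy `σN` under which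
all original winners still win, all members of `C` win. -/
def StrongBeneficialDeviation (G : LTLGame Ag St Ac AP) (C : Set Ag)
    (σ : Profile St Ac) (σC : ∀ i ∈ C, Strategy St (Ac i)) : Prop :=
  C.Nonempty ∧
  C ⊆ (G.winners (G.M.run σ))ᶜ ∧
  C ⊆ G.winners (G.M.run (combine C σC (fun i _ => σ i))) ∧
  ∀ σN : ∀ i ∉ C, Strategy St (Ac i),
    G.winners (G.M.run σ) ⊆ G.winners (G.M.run (combine C σC σN)) →
      C ⊆ G.winners (G.M.run (combine C σC σN))

/-- A strategy profile is in the strong core iff no coalition has a strong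
beneficial deviation from it. -/
def inStrongCore (G : LTLGame Ag St Ac AP) (σ : Profile St Ac) : Prop :=
  ∀ (C : Set Ag) (σC : ∀ i ∈ C, Strategy St (Ac i)),
    ¬ G.StrongBeneficialDeviation C σ σC

/-- `(G, φ) ∈ E-Core` iff some member of the core of `G` induces a run
satisfying `φ`. -/
def ECore (G : LTLGame Ag St Ac AP) (φ : LTLFormula AP) : Prop :=
  ∃ σ : Profile St Ac, G.inCore σ ∧ φ.Sat G.lab (G.M.run σ)

end LTLGame

/-- A two-player game in which player `true` alone chooses the next state.  Player `true` has a
tautological goal, while player `false` wants the second state of the run to be `true`. -/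
def dictatorGame : LTLGame Bool Bool (fun _ => Bool) Unit where
  M := { init := false, tr := fun _ a => a true }
  lab := fun s => {_p | s = true}
  goal := fun i => if i then .disj (.atom ()) (.neg (.atom ())) else .next (.atom ())

theorem true_mem_winners_dictatorGame (ρ : ℕ → Bool) : true ∈ dictatorGame.winners ρ :=
  Classical.em _

theorem false_mem_winners_dictatorGame_iff (σ : Profile Bool (fun _ : Bool => Bool)) :
    false ∈ dictatorGame.winners (dictatorGame.M.run σ) ↔ σ true [false] = true :=
  Iff.rfl

/-- There exist an LTL game `G`, a strategy profile `σ` in the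
core of `G`, and a fulfilled coalition `C ⊆ Ag` such that `C` is not a subset
of `Winners(ρ(σ))`. -/
theorem exists_core_member_not_containing_fulfilled_coalition :
    ∃ (Ag St AP : Type) (Ac : Ag → Type)
      (_ : Fintype Ag) (_ : Nonempty Ag) (_ : Fintype St)
      (_ : ∀ i, Fintype (Ac i)) (_ : ∀ i, Nonempty (Ac i)) (_ : Fintype AP)
      (G : LTLGame Ag St Ac AP) (σ : Profile St Ac) (C : Set Ag),
      G.inCore σ ∧ G.Fulfilled C ∧ ¬ C ⊆ G.winners (G.M.run σ) := by
  refine ⟨Bool, Bool, Unit, fun _ => Bool, inferInstance, inferInstance, inferInstance,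
    fun _ => inferInstance, fun _ => inferInstance, inferInstance,
    dictatorGame, fun _ _ => false, Set.univ, ?_, ⟨Set.univ_nonempty, fun _ _ _ => true, ?_⟩, ?_⟩
  · rintro C σC ⟨⟨i, hi⟩, hlose, hwin⟩
    have htrue : true ∉ C := fun h => hlose h (true_mem_winners_dictatorGame _)
    cases i with
    | true => exact htrue hi
    | false =>
      have h := (false_mem_winners_dictatorGame_iff _).1 (hwin (fun _ _ _ => false) hi)
      simp [combine, htrue] at h
  · rintro σN (_ | _) -
    · rw [false_mem_winners_dictatorGame_iff]
      simp [combine]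
    · exact true_mem_winners_dictatorGame _
  · intro h
    have := (false_mem_winners_dictatorGame_iff _).1 (h (Set.mem_univ false))
    exact Bool.false_ne_true this
end

section
/- For every LTL game G and every fulfilled coalition C ⊆ Ag, there exists a strategy profile σ in the core of G such that C ⊆ Winners(ρ(σ)). -/
namespace LTLGame

variable {Ag St AP : Type} {Ac : Ag → Type}

/-- A profile that agrees with `σC` on `C` is a combination of `σC` with a counter strategy. -/
theorem combine_eq_of_agree (C : Set Ag) (σC : ∀ i ∈ C, Strategy St (Ac i))
    (τ : Profile St Ac) (h : ∀ i (hi : i ∈ C), τ i = σC i hi) :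
    combine C σC (fun i _ => τ i) = τ := by
  funext i
  by_cases hi : i ∈ C
  · simp [combine, hi, h i hi]
  · simp [combine, hi]

/-- The union of two disjoint fulfilled coalitions is fulfilled. -/
theorem Fulfilled.union_of_disjoint {G : LTLGame Ag St Ac AP} {C D : Set Ag}
    (hC : G.Fulfilled C) (hD : G.Fulfilled D) (hdisj : Disjoint C D) :
    G.Fulfilled (C ∪ D) := by
  classical
  obtain ⟨hne, σC, hσC⟩ := hC
  obtain ⟨-, σD, hσD⟩ := hD
  refine ⟨hne.mono Set.subset_union_left,
    fun i hi => if h : i ∈ C then σC i h else σD i (hi.resolve_left h), fun σN => ?_⟩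
  set τ := combine (C ∪ D)
    (fun i hi => if h : i ∈ C then σC i h else σD i (hi.resolve_left h)) σN with hτ
  have h1 := hσC (fun i _ => τ i)
  rw [combine_eq_of_agree C σC τ (fun i hi => by simp [hτ, combine, hi])] at h1
  have h2 := hσD (fun i _ => τ i)
  rw [combine_eq_of_agree D σD τ (fun i hi => by
    simp [hτ, combine, hi, Set.disjoint_right.mp hdisj hi])] at h2
  exact Set.union_subset h1 h2

end LTLGame

/-- For every LTL game `G` and every fulfilled coalition
`C ⊆ Ag`, there exists a strategy profile `σ` in the core of `G` such that
`C ⊆ Winners(ρ(σ))`. -/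
theorem exists_core_member_fulfilling_coalition
    {Ag St AP : Type} {Ac : Ag → Type}
    [Fintype Ag] [Nonempty Ag] [Fintype St]
    [∀ i, Fintype (Ac i)] [∀ i, Nonempty (Ac i)] [Fintype AP]
    (G : LTLGame Ag St Ac AP) (C : Set Ag) (hC : G.Fulfilled C) :
    ∃ σ : Profile St Ac, G.inCore σ ∧ C ⊆ G.winners (G.M.run σ) := by
  obtain ⟨D, hCD, hD⟩ := (Set.toFinite {D | G.Fulfilled D}).exists_le_maximal hC
  obtain ⟨-, σD, hσD⟩ := hD.prop
  let σN : ∀ i ∉ D, Strategy St (Ac i) := fun _ _ _ => Classical.arbitrary _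
  refine ⟨combine D σD σN, fun E σE ⟨hne, hlose, hwin⟩ => ?_, hCD.trans (hσD σN)⟩
  have hdisj : Disjoint D E :=
    Set.disjoint_left.mpr fun i hiD hiE => hlose hiE (hσD σN hiD)
  obtain ⟨i, hi⟩ := hne
  have hunion := hD.prop.union_of_disjoint ⟨⟨i, hi⟩, σE, hwin⟩ hdisj
  exact Set.disjoint_right.mp hdisj hi
    (hD.le_of_ge hunion Set.subset_union_left (Or.inr hi))
end

section
/- For every LTL game G, the core of G is nonempty: there exists a strategy profile σ from which no coalition has a beneficial deviation. -/
namespace LTLGame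

variable {Ag St AP : Type} {Ac : Ag → Type}

/-- The members of `C`, playing their strategies in `τ`, all win whatever the
other players do. -/
def Forces (G : LTLGame Ag St Ac AP) (C : Set Ag) (τ : Profile St Ac) : Prop :=
  ∀ p : Profile St Ac, (∀ i ∈ C, p i = τ i) → C ⊆ G.winners (G.M.run p)

theorem forces_empty (G : LTLGame Ag St Ac AP) (τ : Profile St Ac) : G.Forces ∅ τ :=
  fun _ _ => Set.empty_subset _

/-- Disjoint coalitions can force their goals simultaneously. -/
theorem Forces.union {G : LTLGame Ag St Ac AP} {C D : Set Ag} {τ υ : Profile St Ac}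
    (hC : G.Forces C τ) (hD : G.Forces D υ) (hCD : Disjoint C D) :
    ∃ ω : Profile St Ac, G.Forces (C ∪ D) ω := by
  classical
  refine ⟨fun i => if i ∈ C then τ i else υ i, fun p hp => Set.union_subset ?_ ?_⟩
  · refine hC p fun i hi => ?_
    exact (hp i (Or.inl hi)).trans (if_pos hi)
  · refine hD p fun i hi => ?_
    exact (hp i (Or.inr hi)).trans (if_neg (Set.disjoint_right.1 hCD hi))

/-- A coalition with a beneficial deviation can force its goals. -/
theorem BeneficialDeviation.exists_forces {G : LTLGame Ag St Ac AP} {C : Set Ag}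
    {σ : Profile St Ac} {σC : ∀ i ∈ C, Strategy St (Ac i)}
    (h : G.BeneficialDeviation C σ σC) : ∃ τ : Profile St Ac, G.Forces C τ := by
  refine ⟨combine C σC fun i _ => σ i, fun p hp => ?_⟩
  have hp' : combine C σC (fun i _ => p i) = p := by
    funext i
    by_cases hi : i ∈ C
    · simp [hp i hi, combine, hi]
    · simp [combine, hi]
  exact hp' ▸ h.2.2 fun i _ => p i

end LTLGame

/-- For every LTL game `G`, the core of `G` is nonempty: there
exists a strategy profile `σ` from which no coalition has a beneficial
deviation. -/
theorem core_nonempty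
    {Ag St AP : Type} {Ac : Ag → Type}
    [Fintype Ag] [Nonempty Ag] [Fintype St]
    [∀ i, Fintype (Ac i)] [∀ i, Nonempty (Ac i)] [Fintype AP]
    (G : LTLGame Ag St Ac AP) :
    ∃ σ : Profile St Ac, G.inCore σ := by
  have τ₀ : Profile St Ac := fun i _ => Classical.arbitrary (Ac i)
  obtain ⟨C, ⟨τ, hτ⟩, hmax⟩ := (Set.toFinite {C : Set Ag | ∃ τ, G.Forces C τ}).exists_maximal
    ⟨∅, τ₀, G.forces_empty τ₀⟩
  refine ⟨τ, fun D σD h => ?_⟩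
  obtain ⟨υ, hυ⟩ := h.exists_forces
  have hCD : Disjoint C D :=
    Set.disjoint_left.2 fun i hiC hiD => h.2.1 hiD (hτ τ (fun _ _ => rfl) hiC)
  have hle : C ∪ D ⊆ C := hmax (hτ.union hυ hCD) Set.subset_union_left
  obtain ⟨i, hi⟩ := h.1
  exact Set.disjoint_left.1 hCD (hle (Or.inr hi)) hi
end

section
/- Let G = (M, AP, λ, (γ_i)_{i∈Ag}) be an LTL game, φ an LTL formula over AP, and M' a concurrent game structure (with labelling λ') that is bisimilar to M; let G' = (M', AP, λ', (γ_i)_{i∈Ag}). Then (G, φ) ∈ E-Core if and only if (G', φ) ∈ E-Core. -/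
/-- A bisimulation between two concurrent game structures `M`, `M'` over the
same agents, actions and atomic propositions (with labellings `lab`, `lab'`):
a relation on states relating the initial states, preserving labels, and such
that related states have related successors under every action profile (both
the forth and back conditions; since transition functions are total and
deterministic, both take the same form). -/
structure Bisim {Ag St St' AP : Type} {Ac : Ag → Type}
    (M : CGS Ag St Ac) (M' : CGS Ag St' Ac)
    (lab : St → Set AP) (lab' : St' → Set AP) where
  rel : St → St' → Prop
  initial : rel M.init M'.init
  lab_eq : ∀ {s t}, rel s t → lab s = lab' t
  forth : ∀ {s t} (a : ∀ i, Ac i), rel s t → rel (M.tr s a) (M'.tr t a)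
  back : ∀ {s t} (a : ∀ i, Ac i), rel s t → rel (M.tr s a) (M'.tr t a)

namespace CGS

variable {Ag St St' : Type} {Ac : Ag → Type}

/-- The state sequence generated by a sequence of action profiles. -/
def path (M : CGS Ag St Ac) (a : ℕ → ∀ i, Ac i) : ℕ → St
  | 0 => M.init
  | t + 1 => M.tr (path M a t) (a t)

/-- The finite history of the first `t + 1` entries of a state sequence. -/
def hist (ρ : ℕ → St) (t : ℕ) : List St := (List.range (t + 1)).map ρ

lemma hist_succ (ρ : ℕ → St) (t : ℕ) : hist ρ (t + 1) = hist ρ t ++ [ρ (t + 1)] := by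
  simp [hist, List.range_succ (n := t + 1)]

lemma length_hist (ρ : ℕ → St) (t : ℕ) : (hist ρ t).length = t + 1 := by
  simp [hist]

lemma getD_hist (ρ : ℕ → St) (d : St) {t n : ℕ} (h : n ≤ t) : (hist ρ t).getD n d = ρ n := by
  have : n < t + 1 := by omega
  simp [hist, List.getD, this]

lemma histRun_eq_path (M : CGS Ag St Ac) (σ : Profile St Ac) (a : ℕ → ∀ i, Ac i)
    (h : ∀ t i, a t i = σ i (hist (M.path a) t)) (t : ℕ) :
    M.histRun σ t = (hist (M.path a) t, M.path a t) := by
  induction t with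
  | zero => rfl
  | succ t ih =>
    have ha : (fun i => σ i (hist (M.path a) t)) = a t := funext fun i => (h t i).symm
    simp only [histRun, ih, ha, hist_succ]
    rfl

lemma run_eq_path (M : CGS Ag St Ac) (σ : Profile St Ac) (a : ℕ → ∀ i, Ac i)
    (h : ∀ t i, a t i = σ i (hist (M.path a) t)) : M.run σ = M.path a :=
  funext fun t => by rw [run, histRun_eq_path M σ a h t]

/-- Every strategy profile generates a sequence of action profiles. -/
lemma exists_actions (M : CGS Ag St Ac) (σ : Profile St Ac) :
    ∃ a : ℕ → ∀ i, Ac i, ∀ t i, a t i = σ i (hist (M.path a) t) := by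
  refine ⟨fun t i => σ i (M.histRun σ t).1, fun t i => ?_⟩
  set a : ℕ → ∀ i, Ac i := fun t i => σ i (M.histRun σ t).1
  have key : ∀ t, M.histRun σ t = (hist (M.path a) t, M.path a t) := by
    intro t
    induction t with
    | zero => rfl
    | succ t ih =>
      have hp : M.path a (t + 1) = M.tr (M.path a t) (a t) := rfl
      have ha : a t = fun i => σ i (hist (M.path a) t) := by
        funext i
        simp only [a, ih]
      rw [hist_succ, hp, ha, histRun, ih]
  exact congrArg (σ i) (congrArg Prod.fst (key t))

/-- Every sequence of action profiles is generated by some strategy profile. -/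
lemma exists_run_eq_path (M : CGS Ag St Ac) (a : ℕ → ∀ i, Ac i) :
    ∃ σ : Profile St Ac, M.run σ = M.path a :=
  ⟨fun i l => a (l.length - 1) i, run_eq_path _ _ _ fun t i => by simp [length_hist]⟩

/-- A sequence of action profiles in which the members of `C` follow `σC`. -/
def Consistent (M : CGS Ag St Ac) (C : Set Ag) (σC : ∀ i ∈ C, Strategy St (Ac i))
    (a : ℕ → ∀ i, Ac i) : Prop :=
  ∀ t i (h : i ∈ C), a t i = σC i h (hist (M.path a) t)

lemma forall_run_combine_iff (M : CGS Ag St Ac) (C : Set Ag)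
    (σC : ∀ i ∈ C, Strategy St (Ac i)) (P : (ℕ → St) → Prop) :
    (∀ σN : ∀ i ∉ C, Strategy St (Ac i), P (M.run (combine C σC σN))) ↔
      ∀ a, M.Consistent C σC a → P (M.path a) := by
  constructor
  · intro H a ha
    have := H fun i _ l => a (l.length - 1) i
    rwa [run_eq_path M _ a] at this
    intro t i
    by_cases hi : i ∈ C
    · simpa [combine, hi] using ha t i hi
    · simp [combine, hi, length_hist]
  · intro H σN
    obtain ⟨a, ha⟩ := M.exists_actions (combine C σC σN)
    rw [run_eq_path M _ a ha]
    refine H a fun t i hi => ?_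
    simpa [combine, hi] using ha t i

section Track

variable [∀ i, Nonempty (Ac i)]

/-- An action profile that follows `σC` after the history `l` in one structure and moves
from `s` to `s'` in `M'`, whenever there is one. -/
noncomputable def pickAction (M' : CGS Ag St' Ac) (C : Set Ag)
    (σC : ∀ i ∈ C, Strategy St (Ac i)) (l : List St) (s s' : St') : ∀ i, Ac i :=
  Classical.epsilon fun a => M'.tr s a = s' ∧ ∀ i (h : i ∈ C), a i = σC i h l

/-- The history of `M` that simulates, along chosen action profiles following `σC`, a state
sequence of `M'`, together with its last state. -/
noncomputable def track (M : CGS Ag St Ac) (M' : CGS Ag St' Ac) (C : Set Ag)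
    (σC : ∀ i ∈ C, Strategy St (Ac i)) (ρ : ℕ → St') : ℕ → List St × St
  | 0 => ([M.init], M.init)
  | t + 1 =>
      let p := track M M' C σC ρ t
      let s := M.tr p.2 (pickAction M' C σC p.1 (ρ t) (ρ (t + 1)))
      (p.1 ++ [s], s)

lemma track_congr (M : CGS Ag St Ac) (M' : CGS Ag St' Ac) (C : Set Ag)
    (σC : ∀ i ∈ C, Strategy St (Ac i)) {ρ ρ' : ℕ → St'} {t : ℕ}
    (h : ∀ n ≤ t, ρ n = ρ' n) : track M M' C σC ρ t = track M M' C σC ρ' t := by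
  induction t with
  | zero => rfl
  | succ t ih =>
    simp only [track, ih fun n hn => h n (by omega), h t (by omega), h (t + 1) le_rfl]

/-- The joint strategy in `M'` that simulates `σC`. -/
noncomputable def transfer (M : CGS Ag St Ac) (M' : CGS Ag St' Ac) (C : Set Ag)
    (σC : ∀ i ∈ C, Strategy St (Ac i)) : ∀ i ∈ C, Strategy St' (Ac i) :=
  fun i hi l => σC i hi (track M M' C σC (fun n => l.getD n M'.init) (l.length - 1)).1

lemma transfer_hist (M : CGS Ag St Ac) (M' : CGS Ag St' Ac) (C : Set Ag)
    (σC : ∀ i ∈ C, Strategy St (Ac i)) (ρ : ℕ → St') (t : ℕ) (i : Ag) (hi : i ∈ C) :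
    transfer M M' C σC i hi (hist ρ t) = σC i hi (track M M' C σC ρ t).1 := by
  simp only [transfer, length_hist, Nat.add_sub_cancel]
  rw [track_congr M M' C σC fun n hn => getD_hist ρ M'.init hn]

/-- A path of `M'` following the transferred strategy is also generated by a sequence of action
profiles that follows the original strategy in `M`. -/
lemma Consistent.exists_of_transfer {M : CGS Ag St Ac} {M' : CGS Ag St' Ac} {C : Set Ag}
    {σC : ∀ i ∈ C, Strategy St (Ac i)} {a : ℕ → ∀ i, Ac i}
    (ha : M'.Consistent C (transfer M M' C σC) a) :
    ∃ b, M.Consistent C σC b ∧ M'.path b = M'.path a := by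
  set ρ := M'.path a with hρ
  let b : ℕ → ∀ i, Ac i := fun t =>
    pickAction M' C σC (track M M' C σC ρ t).1 (ρ t) (ρ (t + 1))
  have hb : ∀ t, M'.tr (ρ t) (b t) = ρ (t + 1) ∧
      ∀ i (h : i ∈ C), b t i = σC i h (track M M' C σC ρ t).1 := fun t =>
    Classical.epsilon_spec
      (p := fun a : ∀ i, Ac i => M'.tr (ρ t) a = ρ (t + 1) ∧
        ∀ i (h : i ∈ C), a i = σC i h (track M M' C σC ρ t).1)
      ⟨a t, rfl, fun i hi => by rw [ha t i hi, ← hρ, transfer_hist]⟩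
  have htrack : ∀ t, track M M' C σC ρ t = (hist (M.path b) t, M.path b t) := by
    intro t
    induction t with
    | zero => rfl
    | succ t ih =>
      have hp : M.path b (t + 1) = M.tr (M.path b t)
        (pickAction M' C σC (track M M' C σC ρ t).1 (ρ t) (ρ (t + 1))) := rfl
      rw [hist_succ, hp, track, ih]
  refine ⟨b, fun t i hi => by rw [(hb t).2 i hi, htrack], funext fun t => ?_⟩
  induction t with
  | zero => rfl
  | succ t ih => rw [← (hb t).1, ← ih, path]

end Track

end CGS

lemma LTLFormula.sat_congr {AP St St' : Type} {lab : St → Set AP} {lab' : St' → Set AP}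
    (φ : LTLFormula AP) {ρ : ℕ → St} {ρ' : ℕ → St'} (h : ∀ t, lab (ρ t) = lab' (ρ' t)) :
    φ.Sat lab ρ ↔ φ.Sat lab' ρ' := by
  induction φ generalizing ρ ρ' with
  | atom p => simp only [Sat, h]
  | neg φ ih => simp only [Sat, ih h]
  | disj φ ψ ih₁ ih₂ => simp only [Sat, ih₁ h, ih₂ h]
  | next φ ih => exact ih fun t => h (t + 1)
  | untl φ ψ ih₁ ih₂ =>
    exact exists_congr fun j => and_congr (ih₂ fun t => h (t + j))
      (forall₂_congr fun k _ => ih₁ fun t => h (t + k))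

namespace Bisim

variable {Ag St St' AP : Type} {Ac : Ag → Type} {M : CGS Ag St Ac} {M' : CGS Ag St' Ac}
  {lab : St → Set AP} {lab' : St' → Set AP}

/-- The converse of a bisimulation. -/
def symm (B : Bisim M M' lab lab') : Bisim M' M lab' lab where
  rel s t := B.rel t s
  initial := B.initial
  lab_eq h := (B.lab_eq h).symm
  forth a h := B.forth a h
  back a h := B.back a h

lemma rel_path (B : Bisim M M' lab lab') (a : ℕ → ∀ i, Ac i) (t : ℕ) :
    B.rel (M.path a t) (M'.path a t) := by
  induction t with
  | zero => exact B.initial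
  | succ t ih => exact B.forth (a t) ih

lemma sat_path_iff (B : Bisim M M' lab lab') (φ : LTLFormula AP) (a : ℕ → ∀ i, Ac i) :
    φ.Sat lab (M.path a) ↔ φ.Sat lab' (M'.path a) :=
  φ.sat_congr fun t => B.lab_eq (B.rel_path a t)

lemma winners_path (B : Bisim M M' lab lab') (γ : Ag → LTLFormula AP) (a : ℕ → ∀ i, Ac i) :
    LTLGame.winners ⟨M, lab, γ⟩ (M.path a) = LTLGame.winners ⟨M', lab', γ⟩ (M'.path a) :=
  Set.ext fun i => B.sat_path_iff (γ i) a

lemma fulfilled [∀ i, Nonempty (Ac i)] (B : Bisim M M' lab lab') (γ : Ag → LTLFormula AP)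
    {C : Set Ag} (h : LTLGame.Fulfilled ⟨M, lab, γ⟩ C) :
    LTLGame.Fulfilled ⟨M', lab', γ⟩ C := by
  obtain ⟨hC, σC, hσ⟩ := h
  refine ⟨hC, CGS.transfer M M' C σC, ?_⟩
  have hwin := (M.forall_run_combine_iff C σC
    fun ρ => C ⊆ LTLGame.winners ⟨M, lab, γ⟩ ρ).1 hσ
  refine (M'.forall_run_combine_iff C _ fun ρ => C ⊆ LTLGame.winners ⟨M', lab', γ⟩ ρ).2 ?_
  intro a ha
  obtain ⟨b, hb, hba⟩ := ha.exists_of_transfer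
  rw [← hba, ← B.winners_path]
  exact hwin b hb

lemma eCore [∀ i, Nonempty (Ac i)] (B : Bisim M M' lab lab') (γ : Ag → LTLFormula AP)
    (φ : LTLFormula AP) (h : LTLGame.ECore ⟨M, lab, γ⟩ φ) :
    LTLGame.ECore ⟨M', lab', γ⟩ φ := by
  obtain ⟨σ, hσ, hφ⟩ := h
  obtain ⟨a, ha⟩ := M.exists_actions σ
  have hrun := M.run_eq_path σ a ha
  obtain ⟨σ', hrun'⟩ := M'.exists_run_eq_path a
  refine ⟨σ', fun C σC' hdev => ?_, ?_⟩
  · obtain ⟨hC, hlose, hwin⟩ := hdev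
    obtain ⟨_, σC, hσC⟩ := B.symm.fulfilled γ ⟨hC, σC', hwin⟩
    refine hσ C σC ⟨hC, ?_, hσC⟩
    change C ⊆ (LTLGame.winners ⟨M, lab, γ⟩ (M.run σ))ᶜ
    change C ⊆ (LTLGame.winners ⟨M', lab', γ⟩ (M'.run σ'))ᶜ at hlose
    rwa [hrun, B.winners_path, ← hrun']
  · change φ.Sat lab (M.run σ) at hφ
    change φ.Sat lab' (M'.run σ')
    rwa [hrun', ← B.sat_path_iff, ← hrun]

end Bisim

/-- Let `G = (M, AP, λ, (γ_i))` be an LTL game, `φ` an LTL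
formula over `AP`, and `M'` a concurrent game structure (with labelling `λ'`)
that is bisimilar to `M`; let `G' = (M', AP, λ', (γ_i))`. Then
`(G, φ) ∈ E-Core` iff `(G', φ) ∈ E-Core`. -/
theorem ECore_bisim_invariant
    {Ag St St' AP : Type} {Ac : Ag → Type}
    [Fintype Ag] [Nonempty Ag] [Fintype St] [Fintype St']
    [∀ i, Fintype (Ac i)] [∀ i, Nonempty (Ac i)] [Fintype AP]
    (M : CGS Ag St Ac) (M' : CGS Ag St' Ac)
    (lab : St → Set AP) (lab' : St' → Set AP)
    (γ : Ag → LTLFormula AP) (φ : LTLFormula AP)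
    (hbisim : Nonempty (Bisim M M' lab lab')) :
    LTLGame.ECore ⟨M, lab, γ⟩ φ ↔ LTLGame.ECore ⟨M', lab', γ⟩ φ := by
  obtain ⟨B⟩ := hbisim
  exact ⟨B.eCore γ φ, B.symm.eCore γ φ⟩
end

section
/- For every three-player LTL game G (|Ag| = 3), the strong core SC(G) is nonempty. -/
theorem exists_third_of_card_eq_three {α : Type*} [Fintype α] (hcard : Fintype.card α = 3)
    {a b : α} (hab : a ≠ b) : ∃ c, c ≠ a ∧ c ≠ b ∧ ∀ x, x = a ∨ x = b ∨ x = c := by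
  classical
  have hpair : ({a, b}ᶜ : Finset α).card = 1 := by
    rw [Finset.card_compl, Finset.card_pair hab, hcard]
  obtain ⟨c, hc⟩ := Finset.card_eq_one.mp hpair
  have key : ∀ x, (x ≠ a ∧ x ≠ b) ↔ x = c := fun x => by
    simpa using Finset.ext_iff.mp hc x
  refine ⟨c, ((key c).mpr rfl).1, ((key c).mpr rfl).2, fun x => ?_⟩
  have := key x
  tauto

/-- A fixed-point-free self-map of a three-element type swaps two points or is surjective. -/
theorem exists_swap_or_surjective_of_card_eq_three {α : Type*} [Fintype α]
    (hcard : Fintype.card α = 3) (f : α → α) (hf : ∀ a, f a ≠ a) :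
    (∃ a, f (f a) = a) ∨ Function.Surjective f := by
  by_cases hswap : ∃ a, f (f a) = a
  · exact Or.inl hswap
  refine Or.inr (Finite.injective_iff_surjective.mp fun a b hab => ?_)
  by_contra hne
  obtain ⟨c, hca, hcb, h⟩ := exists_third_of_card_eq_three hcard hne
  push Not at hswap
  have := h (f a)
  have := h (f c)
  have := hswap c
  grind

/-- In a three-player game in strategic form with win set `W p` at each profile `p`,
some profile admits no strong beneficial deviation. The deviation of a coalition `C` is recorded
by the whole profile `s` resulting from it. -/
theorem exists_no_strong_deviation {ι : Type*} [Fintype ι] {X : ι → Type*}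
    [∀ i, Nonempty (X i)] (hcard : Fintype.card ι = 3) (W : (∀ i, X i) → Set ι) :
    ∃ p, ∀ (C : Set ι) (s : ∀ i, X i), C.Nonempty → C ⊆ (W p)ᶜ → (∀ i ∉ C, s i = p i) →
      C ⊆ W s → ¬ ∀ q, (∀ i ∈ C, q i = s i) → W p ⊆ W q → C ⊆ W q := by
  classical
  by_contra! h
  have not_all : ∀ p, ¬ ∀ i, i ∈ W p := fun p hp => by
    obtain ⟨C, -, ⟨i, hi⟩, hC, -⟩ := h p
    exact hC hi (hp i)
  -- the strategies of `i` that prevent the two other players from winning together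
  let D : ∀ i, Set (X i) := fun i => {x | ∀ q, q i = x → ∃ j, j ≠ i ∧ j ∉ W q}
  have mem_D : ∀ (p s : ∀ i, X i) (i : ι), i ∉ W p →
      (∀ q, q i = s i → W p ⊆ W q → i ∈ W q) → s i ∈ D i := by
    intro p s i hi hs q hq
    by_contra! hall
    refine not_all q fun j => ?_
    by_cases hj : j = i
    · subst hj
      exact hs q hq fun k hk => hall k fun hki => hi (hki ▸ hk)
    · exact hall j hj
  have D_nonempty : ∀ i, ∃ x, x ∈ D i := by
    intro i
    by_cases hp : ∃ p, ∀ j, j ≠ i → j ∈ W p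
    · obtain ⟨p, hp⟩ := hp
      obtain ⟨C, s, ⟨k, hk⟩, hCW, -, -, hs⟩ := h p
      have hC : ∀ j ∈ C, j = i := fun j hj => by
        by_contra hji
        exact hCW hj (hp j hji)
      obtain rfl := hC k hk
      exact ⟨s k, mem_D p s k (hCW hk) fun q hq hW =>
        hs q (fun j hj => by rw [hC j hj, hq]) hW hk⟩
    · push Not at hp
      exact ⟨Classical.arbitrary _, fun q _ => hp q⟩
  have unique_winner : ∀ p, (∀ i, p i ∈ D i) → ∀ a ∈ W p, ∀ b ∈ W p, a = b := by
    intro p hp a ha b hb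
    by_contra hab
    obtain ⟨c, hca, hcb, hall⟩ := exists_third_of_card_eq_three hcard hab
    obtain ⟨j, hjc, hj⟩ := hp c p rfl
    have := hall j
    grind
  have deviation : ∀ p, (∀ i, p i ∈ D i) → ∃ i, ∃ s : ∀ i, X i, i ∉ W p ∧ (∀ j, s j ∈ D j) ∧
      (∀ j, j ≠ i → s j = p j) ∧ i ∈ W s ∧ ∀ q, q i = s i → W p ⊆ W q → i ∈ W q := by
    intro p hp
    obtain ⟨C, s, ⟨i, hi⟩, hCW, hsp, hCs, hs⟩ := h p
    have hC : ∀ j ∈ C, j = i := fun j hj => by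
      by_contra hji
      obtain ⟨c, hcj, hci, hall⟩ := exists_third_of_card_eq_three hcard hji
      by_cases hc : c ∈ C
      · exact not_all s fun k => hCs (by have := hall k; grind)
      · obtain ⟨k, hkc, hk⟩ := hp c s (hsp c hc)
        have := hCs hi
        have := hCs hj
        have := hall k
        grind
    have hdev : ∀ q, q i = s i → W p ⊆ W q → i ∈ W q := fun q hq hW =>
      hs q (fun j hj => by rw [hC j hj, hq]) hW hi
    have heq : ∀ j, j ≠ i → s j = p j := fun j hj => hsp j fun hjC => hj (hC j hjC)
    refine ⟨i, s, hCW hi, fun j => ?_, heq, hCs hi, hdev⟩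
    by_cases hj : j = i
    · subst hj
      exact mem_D p s j (hCW hi) hdev
    · rw [heq j hj]
      exact hp j
  have exists_winner : ∀ p, (∀ i, p i ∈ D i) → ∃ w, w ∈ W p := by
    intro p hp
    by_contra! hW
    obtain ⟨i, s, -, hsD, -, his, hs⟩ := deviation p hp
    obtain ⟨j, t, hj, htD, hts, hjt, -⟩ := deviation s hsD
    have hij : i ≠ j := fun e => hj (e ▸ his)
    exact hij (unique_winner t htD i (hs t (hts i hij) fun k hk => (hW k hk).elim) j hjt)
  have denied : ∀ w, ∃ i, i ≠ w ∧ ∃ x ∈ D i, ∀ q, (∀ j, q j ∈ D j) → q i = x → w ∉ W q := by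
    intro w
    by_cases hw : ∃ p, (∀ i, p i ∈ D i) ∧ w ∈ W p
    · obtain ⟨p, hp, hw⟩ := hw
      obtain ⟨i, s, hi, hsD, -, -, hs⟩ := deviation p hp
      have hiw : i ≠ w := fun e => hi (e ▸ hw)
      refine ⟨i, hiw, s i, hsD i, fun q hq hqi hwq => hiw ?_⟩
      refine unique_winner q hq i (hs q hqi fun k hk => ?_) w hwq
      rwa [unique_winner p hp k hk w hw]
    · push Not at hw
      have : Nontrivial ι := Fintype.one_lt_card_iff_nontrivial.mp (by omega)
      obtain ⟨i, hi⟩ := exists_ne w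
      obtain ⟨x, hx⟩ := D_nonempty i
      exact ⟨i, hi, x, hx, fun q hq _ => hw q hq⟩
  choose f hf x hxD hx using denied
  choose d hd using D_nonempty
  rcases exists_swap_or_surjective_of_card_eq_three hcard f hf with ⟨a, ha⟩ | hsurj
  · let p : ∀ i, X i := Function.update (Function.update d (f a) (x a)) (f (f a)) (x (f a))
    have hpfa : p (f a) = x a := by
      dsimp only [p]
      rw [Function.update_of_ne (hf (f a)).symm, Function.update_self]
    have hpa : p (f (f a)) = x (f a) := Function.update_self ..
    have hpD : ∀ i, p i ∈ D i := by
      intro i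
      by_cases h1 : i = f (f a)
      · subst h1; rw [hpa]; exact hxD _
      by_cases h2 : i = f a
      · subst h2; rw [hpfa]; exact hxD _
      · dsimp only [p]
        rw [Function.update_of_ne h1, Function.update_of_ne h2]
        exact hd i
    obtain ⟨i, s, hi, hsD, hsp, his, -⟩ := deviation p hpD
    obtain ⟨w, hw⟩ := exists_winner p hpD
    obtain ⟨c, -, -, hall⟩ := exists_third_of_card_eq_three hcard (hf a)
    have := hall w
    have := hall i
    have hwa : w ≠ a := fun e => hx a p hpD hpfa (e ▸ hw)
    have hwfa : w ≠ f a := fun e => hx (f a) p hpD hpa (e ▸ hw)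
    have hiw : i ≠ w := fun e => hi (e ▸ hw)
    by_cases hia : i = a
    · subst hia
      exact hx i s hsD ((hsp _ (hf i)).trans hpfa) his
    · have hif : i = f a := by grind
      subst hif
      exact hx (f a) s hsD ((hsp _ (hf (f a))).trans hpa) his
  · have hinj : Function.Injective f := Finite.injective_iff_surjective.mpr hsurj
    have hp : ∃ p : ∀ i, X i, ∀ w, p (f w) = x w := by
      choose g hg using hsurj
      refine ⟨fun i => hg i ▸ x (g i), fun w => ?_⟩
      have key : ∀ v (e : f v = f w), (e ▸ x v : X (f w)) = x w := by
        intro v e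
        obtain rfl := hinj e
        rfl
      exact key _ (hg (f w))
    obtain ⟨p, hp⟩ := hp
    have hpD : ∀ i, p i ∈ D i := by
      intro i
      obtain ⟨w, rfl⟩ := hsurj i
      rw [hp]
      exact hxD w
    obtain ⟨w, hw⟩ := exists_winner p hpD
    exact hx w p hpD (hp w) hw

/-- For every three-player LTL game `G` (`|Ag| = 3`), the strong
core `SC(G)` is nonempty. -/
theorem strongCore_nonempty_of_three_players
    {Ag St AP : Type} {Ac : Ag → Type}
    [Fintype Ag] [Fintype St]
    [∀ i, Fintype (Ac i)] [∀ i, Nonempty (Ac i)] [Fintype AP]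
    (hcard : Fintype.card Ag = 3)
    (G : LTLGame Ag St Ac AP) :
    ∃ σ : Profile St Ac, G.inStrongCore σ := by
  obtain ⟨σ, hσ⟩ := exists_no_strong_deviation (X := fun i => Strategy St (Ac i)) hcard
    (fun σ => G.winners (G.M.run σ))
  refine ⟨σ, ?_⟩
  rintro C σC ⟨hne, hlose, hwin, hstrong⟩
  refine hσ C (combine C σC fun i _ => σ i) hne hlose (fun i hi => by simp [combine, hi]) hwin
    fun q hq hW => ?_
  have hqC : combine C σC (fun i _ => q i) = q := by
    funext i
    by_cases hi : i ∈ C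
    · simp [combine, hi, hq i hi]
    · simp [combine, hi]
  have := hstrong fun i _ => q i
  rw [hqC] at this
  exact this hW
end

section
/- For every mean-payoff game G with at most two players (|Ag| ≤ 2), the core of G is nonempty. -/
/-- A mean-payoff game: a concurrent game structure together with an integer
weight function on states for each player. -/
structure MPGame (Ag St : Type) (Ac : Ag → Type) where
  M : CGS Ag St Ac
  w : Ag → St → ℤ

/-- The mean-payoff of an infinite sequence of reals:
`liminf_{n→∞} (1/n) Σ_{t<n} β t`. -/
noncomputable def meanPayoff (β : ℕ → ℝ) : ℝ :=
  Filter.liminf (fun n : ℕ => (∑ t ∈ Finset.range n, β t) / (n : ℝ)) Filter.atTop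

namespace MPGame

variable {Ag St : Type} {Ac : Ag → Type}

/-- The payoff of player `i` on the run `ρ`: the mean-payoff of the induced
sequence of weights. -/
noncomputable def pay (G : MPGame Ag St Ac) (i : Ag) (ρ : ℕ → St) : ℝ :=
  meanPayoff fun t => (G.w i (ρ t) : ℝ)

/-- `σC` is a beneficial deviation for the (nonempty) coalition `C` from `σ`:
for every joint strategy `σN` of the other players, every member of `C` gets
a strictly larger payoff under `(σC, σN)` than under `σ`. -/
def BeneficialDeviation (G : MPGame Ag St Ac) (C : Set Ag)
    (σ : Profile St Ac) (σC : ∀ i ∈ C, Strategy St (Ac i)) : Prop :=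
  C.Nonempty ∧
  ∀ σN : ∀ i ∉ C, Strategy St (Ac i), ∀ i ∈ C,
    G.pay i (G.M.run (combine C σC σN)) > G.pay i (G.M.run σ)

/-- A strategy profile is in the core iff no coalition has a beneficial
deviation from it. -/
def inCore (G : MPGame Ag St Ac) (σ : Profile St Ac) : Prop :=
  ∀ (C : Set Ag) (σC : ∀ i ∈ C, Strategy St (Ac i)),
    ¬ G.BeneficialDeviation C σ σC

/-- `z` is a lower bound for the coalition `C`: `C` has a joint strategy that
guarantees each member `i ∈ C` a payoff of at least `z i`, against every
joint strategy of the remaining players. -/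
def IsLowerBound (G : MPGame Ag St Ac) (C : Set Ag) (z : Ag → ℚ) : Prop :=
  ∃ σC : ∀ i ∈ C, Strategy St (Ac i),
    ∀ σN : ∀ i ∉ C, Strategy St (Ac i), ∀ i ∈ C,
      (z i : ℝ) ≤ G.pay i (G.M.run (combine C σC σN))

end MPGame

/-- The strategy corresponding to a memoryless strategy `f : St → A`: at any
history it plays the action assigned to the current (last) state.  (`s0` is a
default value, irrelevant since histories are nonempty.) -/
def memorylessLift {St A : Type} (s0 : St) (f : St → A) : Strategy St A :=
  fun h => f (h.getLastD s0)

open Filter in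
/-- A real sequence that is eventually nonnegative is bounded below. -/
theorem exists_forall_neg_le_of_eventually_nonneg {a : ℕ → ℝ} (h : ∀ᶠ k in atTop, 0 ≤ a k) :
    ∃ C : ℝ, ∀ k, -C ≤ a k := by
  obtain ⟨N, hN⟩ := eventually_atTop.1 h
  refine ⟨∑ l ∈ Finset.range N, |a l|, fun k => ?_⟩
  by_cases hk : N ≤ k
  · have : 0 ≤ ∑ l ∈ Finset.range N, |a l| := Finset.sum_nonneg fun _ _ => abs_nonneg _
    linarith [hN k hk]
  · have := Finset.single_le_sum (f := fun l => |a l|) (fun _ _ => abs_nonneg _)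
      (Finset.mem_range.2 (not_le.1 hk))
    have h2 := neg_abs_le (a k)
    linarith

open Filter in
/-- The partial sums of an eventually nonnegative sequence are bounded below. -/
theorem exists_forall_neg_le_sum_of_eventually_nonneg {a : ℕ → ℝ}
    (h : ∀ᶠ k in atTop, 0 ≤ a k) : ∃ C : ℝ, ∀ k, -C ≤ ∑ l ∈ Finset.range k, a l := by
  obtain ⟨N, hN⟩ := eventually_atTop.1 h
  obtain ⟨C, hC⟩ := exists_forall_neg_le_of_eventually_nonneg
    (a := fun k => ∑ l ∈ Finset.range k, a l - ∑ l ∈ Finset.range N, a l) <| by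
      filter_upwards [eventually_ge_atTop N] with k hk
      induction k, hk using Nat.le_induction with
      | base => simp
      | succ k hk ih => rw [Finset.sum_range_succ]; linarith [hN k hk]
  exact ⟨C - ∑ l ∈ Finset.range N, a l, fun k => by linarith [hC k]⟩

section MeanPayoff

open Filter

variable {β : ℕ → ℝ} {W x : ℝ}

theorem abs_average_le (hb : ∀ t, |β t| ≤ W) (n : ℕ) :
    |(∑ t ∈ Finset.range n, β t) / (n : ℝ)| ≤ W := by
  have hW : 0 ≤ W := (abs_nonneg _).trans (hb 0)
  rcases Nat.eq_zero_or_pos n with rfl | hn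
  · simpa using hW
  · have hn' : (0 : ℝ) < n := by exact_mod_cast hn
    rw [abs_div, abs_of_pos hn', div_le_iff₀ hn']
    calc _ ≤ ∑ t ∈ Finset.range n, |β t| := Finset.abs_sum_le_sum_abs _ _
      _ ≤ ∑ t ∈ Finset.range n, W := Finset.sum_le_sum fun t _ => hb t
      _ = W * n := by simp [mul_comm]

theorem isBoundedUnder_ge_average (hb : ∀ t, |β t| ≤ W) :
    IsBoundedUnder (· ≥ ·) atTop
      fun n : ℕ => (∑ t ∈ Finset.range n, β t) / (n : ℝ) :=
  isBoundedUnder_of ⟨-W, fun n => (abs_le.1 (abs_average_le hb n)).1⟩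

theorem isCoboundedUnder_ge_average (hb : ∀ t, |β t| ≤ W) :
    IsCoboundedUnder (· ≥ ·) atTop
      fun n : ℕ => (∑ t ∈ Finset.range n, β t) / (n : ℝ) :=
  (isBoundedUnder_of ⟨W, fun n => (abs_le.1 (abs_average_le hb n)).2⟩ :
    IsBoundedUnder (· ≤ ·) atTop _).isCoboundedUnder_ge

theorem le_meanPayoff_of_forall_sub (hb : ∀ t, |β t| ≤ W)
    (h : ∀ ε > 0, ∃ C, ∀ t : ℕ, (x - ε) * t - C ≤ ∑ u ∈ Finset.range t, β u) :
    x ≤ meanPayoff β := by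
  refine le_of_forall_pos_le_add fun ε hε => ?_
  obtain ⟨C, hC⟩ := h (ε / 2) (by positivity)
  suffices x - ε ≤ meanPayoff β by linarith
  refine le_liminf_of_le (isCoboundedUnder_ge_average hb) ?_
  filter_upwards [eventually_gt_atTop 0,
    (tendsto_natCast_atTop_atTop (R := ℝ)).eventually_ge_atTop (2 * C / ε)] with n hn hn2
  have hn' : (0 : ℝ) < n := by exact_mod_cast hn
  rw [le_div_iff₀ hn']
  rw [div_le_iff₀ hε] at hn2
  linarith [hC n]

theorem le_meanPayoff (hb : ∀ t, |β t| ≤ W) {C : ℝ}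
    (h : ∀ t : ℕ, x * t - C ≤ ∑ u ∈ Finset.range t, β u) : x ≤ meanPayoff β :=
  le_meanPayoff_of_forall_sub hb fun ε hε => ⟨C, fun t => by
    have : 0 ≤ ε * (t : ℝ) := by positivity
    linarith [h t]⟩

theorem eventually_le_sum_of_le_meanPayoff (hb : ∀ t, |β t| ≤ W) (h : x ≤ meanPayoff β)
    {ε : ℝ} (hε : 0 < ε) :
    ∀ᶠ t : ℕ in atTop, (x - ε) * t ≤ ∑ u ∈ Finset.range t, β u := by
  have h1 : x - ε < liminf (fun n : ℕ => (∑ t ∈ Finset.range n, β t) / (n : ℝ)) atTop :=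
    lt_of_lt_of_le (by linarith) h
  filter_upwards [eventually_lt_of_lt_liminf h1 (isBoundedUnder_ge_average hb),
    eventually_gt_atTop 0] with n hn hn0
  have hn' : (0 : ℝ) < n := by exact_mod_cast hn0
  exact ((lt_div_iff₀ hn').1 hn).le

theorem meanPayoff_le (hb : ∀ t, |β t| ≤ W) {C : ℝ}
    (h : ∀ t : ℕ, ∑ u ∈ Finset.range t, β u ≤ x * t + C) : meanPayoff β ≤ x := by
  by_contra! hlt
  have hδ : 0 < (meanPayoff β - x) / 2 := by linarith
  obtain ⟨t, ht, htC⟩ := ((eventually_le_sum_of_le_meanPayoff hb le_rfl hδ).and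
    ((tendsto_natCast_atTop_atTop (R := ℝ)).eventually_gt_atTop
      (C / ((meanPayoff β - x) / 2)))).exists
  rw [div_lt_iff₀ hδ] at htC
  linarith [h t]

theorem neg_le_meanPayoff (hb : ∀ t, |β t| ≤ W) : -W ≤ meanPayoff β :=
  le_meanPayoff hb (C := 0) fun t => by
    have := Finset.sum_le_sum (s := Finset.range t) fun u _ => (abs_le.1 (hb u)).1
    simp at this ⊢
    linarith

theorem meanPayoff_le_bound (hb : ∀ t, |β t| ≤ W) : meanPayoff β ≤ W :=
  meanPayoff_le hb (C := 0) fun t => by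
    have := Finset.sum_le_sum (s := Finset.range t) fun u _ => (abs_le.1 (hb u)).2
    simp at this ⊢
    linarith

/-- The sum over a late enough window starting at `t₀` is almost `x` times its length. -/
theorem eventually_le_sum_window (hb : ∀ t, |β t| ≤ W) (h : x ≤ meanPayoff β)
    {ε : ℝ} (hε : 0 < ε) (t₀ : ℕ) :
    ∀ᶠ L : ℕ in atTop, (x - ε) * L ≤ ∑ u ∈ Finset.range L, β (t₀ + u) := by
  have h1 := (tendsto_add_atTop_nat t₀).eventually
    (eventually_le_sum_of_le_meanPayoff hb h (half_pos hε))
  filter_upwards [h1, (tendsto_natCast_atTop_atTop (R := ℝ)).eventually_ge_atTop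
    ((∑ u ∈ Finset.range t₀, β u - (x - ε / 2) * t₀) / (ε / 2))] with L hL hL2
  rw [div_le_iff₀ (half_pos hε)] at hL2
  rw [add_comm L t₀, Finset.sum_range_add] at hL
  push_cast at hL
  linarith

end MeanPayoff

section Energy

open Filter

variable {S A : Type}

/-- The credit that the responder needs to keep the accumulated `u` nonnegative for `k` steps,
when the opponent picks `a : A` at state `s` and the responder then picks a successor
in `R s a`. -/
noncomputable def requiredCredit (R : S → A → Set S) (u : S → ℝ) : ℕ → S → ℝ
  | 0, _ => 0
  | k + 1, s => max 0 ((⨆ a, ⨅ t : R s a, requiredCredit R u k t) - u s)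

variable {R : S → A → Set S} {u : S → ℝ}

theorem requiredCredit_nonneg (k : ℕ) (s : S) : 0 ≤ requiredCredit R u k s := by
  cases k with
  | zero => exact le_rfl
  | succ k => exact le_max_left _ _

theorem exists_requiredCredit_le [Finite S] [Finite A]
    (hR : ∀ s a, (R s a).Nonempty) (k : ℕ) (s : S) (a : A) :
    ∃ t ∈ R s a, requiredCredit R u k t ≤ requiredCredit R u (k + 1) s + u s := by
  have := (hR s a).to_subtype
  obtain ⟨t, ht⟩ := exists_eq_ciInf_of_finite (f := fun t : R s a => requiredCredit R u k t)
  refine ⟨t, t.2, ?_⟩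
  have h1 : (⨅ t : R s a, requiredCredit R u k t) ≤ ⨆ a, ⨅ t : R s a, requiredCredit R u k t :=
    le_ciSup (f := fun a => ⨅ t : R s a, requiredCredit R u k t)
      (Set.finite_range _).bddAbove a
  have h2 : (⨆ a, ⨅ t : R s a, requiredCredit R u k t) - u s ≤ requiredCredit R u (k + 1) s :=
    le_max_right _ _
  linarith

theorem exists_le_requiredCredit [Finite S] [Finite A] [Nonempty A] {k : ℕ} {s : S}
    (h : 0 < requiredCredit R u (k + 1) s) :
    ∃ a, ∀ t ∈ R s a, requiredCredit R u (k + 1) s + u s ≤ requiredCredit R u k t := by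
  obtain ⟨a, ha⟩ := exists_eq_ciSup_of_finite
    (f := fun a => ⨅ t : R s a, requiredCredit R u k t)
  refine ⟨a, fun t ht => ?_⟩
  have h1 : (⨅ t : R s a, requiredCredit R u k t) ≤ requiredCredit R u k t :=
    ciInf_le (f := fun t : R s a => requiredCredit R u k t)
      (Set.finite_range _).bddBelow ⟨t, ht⟩
  have h2 : requiredCredit R u (k + 1) s =
      (⨆ a, ⨅ t : R s a, requiredCredit R u k t) - u s := by
    rw [requiredCredit] at h ⊢
    exact max_eq_right ((lt_max_iff.1 h).resolve_left (lt_irrefl _)).le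
  linarith

theorem monotone_requiredCredit [Finite S] [Finite A] [Nonempty A]
    (hR : ∀ s a, (R s a).Nonempty) (s : S) :
    Monotone fun k => requiredCredit R u k s := by
  refine monotone_nat_of_le_succ fun k => ?_
  induction k generalizing s with
  | zero => exact requiredCredit_nonneg _ _
  | succ k ih =>
    rcases (requiredCredit_nonneg (R := R) (u := u) (k + 1) s).eq_or_lt with h | h
    · rw [← h]; exact requiredCredit_nonneg _ _
    · obtain ⟨a, ha⟩ := exists_le_requiredCredit h
      obtain ⟨t, ht, htle⟩ := exists_requiredCredit_le (u := u) hR (k + 1) s a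
      linarith [ha t ht, ih t]

/-- Determinacy of energy games: either the responder has a potential certifying that the
accumulated `u` stays bounded below, or the opponent can, within a fixed number `N` of steps,
repeatedly force the accumulated `u` to drop by `1`. -/
theorem energy_dichotomy [Finite S] [Finite A] [Nonempty A]
    (hR : ∀ s a, (R s a).Nonempty) (s₀ : S) :
    (∃ (D : Set S) (f : S → ℝ), s₀ ∈ D ∧ ∀ s ∈ D, 0 ≤ f s ∧
      ∀ a, ∃ t ∈ R s a, t ∈ D ∧ f t ≤ f s + u s) ∨
    (∃ (U : Set S) (N : ℕ) (g : ℕ → S → ℝ), s₀ ∈ U ∧ 0 < N ∧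
      (∀ s ∈ U, g N s + 1 ≤ g 0 s) ∧
      ∀ j < N, ∀ s ∈ U, ∃ a, ∀ t ∈ R s a, t ∈ U ∧ g j s + u s ≤ g (j + 1) t) := by
  have := Fintype.ofFinite S
  set f := requiredCredit R u with hf
  have hmono : ∀ s, Monotone fun k => f k s := monotone_requiredCredit hR
  set D : Set S := {s | BddAbove (Set.range fun k => f k s)} with hD
  by_cases hs₀ : s₀ ∈ D
  · refine Or.inl ⟨D, fun s => ⨆ k, f k s, hs₀, fun s hs => ⟨?_, fun a => ?_⟩⟩
    · exact (requiredCredit_nonneg 0 s).trans (le_ciSup hs 0)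
    · have key : ∃ t ∈ R s a, ∀ k, f k t ≤ (⨆ k, f k s) + u s := by
        by_contra! hcon
        have : ∀ t, ∃ k, t ∈ R s a → (⨆ k, f k s) + u s < f k t := fun t => by
          by_cases ht : t ∈ R s a
          · obtain ⟨k, hk⟩ := hcon t ht
            exact ⟨k, fun _ => hk⟩
          · exact ⟨0, fun h => absurd h ht⟩
        choose k hk using this
        obtain ⟨t, ht, hle⟩ := exists_requiredCredit_le (u := u) hR (Finset.univ.sup k) s a
        have h1 : f (k t) t ≤ f (Finset.univ.sup k) t :=
          hmono t (Finset.le_sup (Finset.mem_univ t))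
        have h2 : f (Finset.univ.sup k + 1) s ≤ ⨆ k, f k s := le_ciSup hs _
        linarith [hk t ht]
      obtain ⟨t, ht, hle⟩ := key
      exact ⟨t, ht, ⟨_, Set.forall_mem_range.2 hle⟩, ciSup_le hle⟩
  · right
    have hU : ∀ M : ℝ, ∀ᶠ k in atTop, ∀ s, s ∉ D → M < f k s := fun M =>
      eventually_all.2 fun s => by
        by_cases hs : s ∈ D
        · exact Eventually.of_forall fun _ h => absurd hs h
        · have hs' : ∃ k, M < f k s := by
            by_contra! hcon
            exact hs ⟨M, Set.forall_mem_range.2 hcon⟩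
          obtain ⟨k, hk⟩ := hs'
          filter_upwards [eventually_ge_atTop k] with l hl _
          exact hk.trans_le (hmono s hl)
    obtain ⟨F, hF⟩ : ∃ F, ∀ s ∈ D, ∀ k, f k s ≤ F := by
      have : ∀ s, ∃ F, s ∈ D → ∀ k, f k s ≤ F := fun s => by
        by_cases hs : s ∈ D
        · obtain ⟨F, hF⟩ := hs
          exact ⟨F, fun _ k => hF ⟨k, rfl⟩⟩
        · exact ⟨0, fun h => absurd h hs⟩
      choose F hF using this
      obtain ⟨B, hB⟩ := (Set.finite_range F).bddAbove
      exact ⟨B, fun s hs k => (hF s hs k).trans (hB ⟨s, rfl⟩)⟩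
    obtain ⟨W, hW⟩ := (Set.finite_range fun s => -u s).bddAbove
    obtain ⟨k₀, hk₀⟩ := eventually_atTop.1 (hU (max 0 (F + W)))
    obtain ⟨C, hC⟩ := (Set.finite_range fun s => f k₀ s).bddAbove
    obtain ⟨k₁, hk₁, hlt⟩ := ((hU (C + 1)).and (eventually_gt_atTop k₀)).exists
    refine ⟨Dᶜ, k₁ - k₀, fun j => f (k₁ - j), hs₀, by omega, fun s hs => ?_,
      fun j hj s hs => ?_⟩
    · have e : k₁ - (k₁ - k₀) = k₀ := by omega
      have h1 : f k₀ s ≤ C := hC ⟨s, rfl⟩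
      simp only [e, Nat.sub_zero]
      linarith [hk₁ s hs]
    · have e : k₁ - j = (k₁ - (j + 1)) + 1 := by omega
      have hpos := hk₀ (k₁ - j) (by omega) s hs
      rw [max_lt_iff] at hpos
      simp only
      rw [e] at hpos ⊢
      obtain ⟨a, ha⟩ := exists_le_requiredCredit hpos.1
      refine ⟨a, fun t ht => ⟨fun htD => ?_, ha t ht⟩⟩
      have h1 : -u s ≤ W := hW ⟨s, rfl⟩
      have h2 := hF t htD (k₁ - (j + 1))
      have h3 := ha t ht
      rw [← hf] at h3
      linarith [hpos.2]

end Energy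

namespace CGS

variable {Ag St : Type} {Ac : Ag → Type} (M : CGS Ag St Ac)

theorem run_succ (σ : Profile St Ac) (t : ℕ) :
    M.run σ (t + 1) = M.tr (M.run σ t) fun i => σ i (M.histRun σ t).1 := rfl

theorem length_histRun (σ : Profile St Ac) (t : ℕ) : (M.histRun σ t).1.length = t + 1 := by
  induction t with
  | zero => rfl
  | succ t ih => simp [histRun, ih]

theorem getLastD_histRun (σ : Profile St Ac) (t : ℕ) (s : St) :
    (M.histRun σ t).1.getLastD s = M.run σ t := by
  cases t with
  | zero => rfl
  | succ t => simp [histRun, run, List.getLastD_eq_getLast?]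

theorem isRun_run (σ : Profile St Ac) : M.IsRun (M.run σ) :=
  ⟨rfl, fun t => ⟨_, M.run_succ σ t⟩⟩

theorem IsRun.exists_run_eq {M : CGS Ag St Ac} {ρ : ℕ → St} (h : M.IsRun ρ) :
    ∃ σ : Profile St Ac, M.run σ = ρ := by
  choose a ha using h.2
  refine ⟨fun i h => a (h.length - 1) i, funext fun t => ?_⟩
  induction t with
  | zero => exact h.1.symm
  | succ t ih => rw [run_succ, ih, ha, length_histRun]; rfl

end CGS

/-- Concatenation of infinitely many finite path segments `c k 0, …, c k (L k)`.  At time `t`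
the resulting path is at position `r t` of segment `k t`. -/
theorem exists_concat {S : Type} (step : S → S → Prop) (c : ℕ → ℕ → S) (L : ℕ → ℕ)
    (hL : ∀ k, 0 < L k) (hstep : ∀ k r, step (c k r) (c k (r + 1)))
    (hjoin : ∀ k, c k (L k) = c (k + 1) 0) :
    ∃ (ρ : ℕ → S) (k r : ℕ → ℕ), ρ 0 = c 0 0 ∧ (∀ t, step (ρ t) (ρ (t + 1))) ∧
      ∀ t, r t < L (k t) ∧ t = ∑ l ∈ Finset.range (k t), L l + r t ∧
        ∀ w : S → ℝ, ∑ v ∈ Finset.range t, w (ρ v) =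
          ∑ l ∈ Finset.range (k t), ∑ v ∈ Finset.range (L l), w (c l v) +
            ∑ v ∈ Finset.range (r t), w (c (k t) v) := by
  let next : ℕ × ℕ → ℕ × ℕ := fun p => if p.2 + 1 < L p.1 then (p.1, p.2 + 1) else (p.1 + 1, 0)
  let pos : ℕ → ℕ × ℕ := fun t => next^[t] (0, 0)
  have hpos : ∀ t, pos (t + 1) = next (pos t) := fun t => Function.iterate_succ_apply' _ _ _
  have hr : ∀ t, (pos t).2 < L (pos t).1 := fun t => by
    induction t with
    | zero => exact hL 0
    | succ t ih =>
      rw [hpos]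
      simp only [next]
      split_ifs with h
      · exact h
      · exact hL _
  refine ⟨fun t => c (pos t).1 (pos t).2, fun t => (pos t).1, fun t => (pos t).2, rfl,
    fun t => ?_, fun t => ⟨hr t, ?_, fun w => ?_⟩⟩
  · simp only [hpos, next]
    split_ifs with h
    · exact hstep _ _
    · have e : (pos t).2 + 1 = L (pos t).1 := by have := hr t; omega
      simp only [← hjoin, ← e]
      exact hstep _ _
  · induction t with
    | zero => rfl
    | succ t ih =>
      simp only [hpos, next]
      simp only at ih
      split_ifs with h
      · simp only; omega
      · have e : (pos t).2 + 1 = L (pos t).1 := by have := hr t; omega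
        simp only [Finset.sum_range_succ]; omega
  · induction t with
    | zero => simp [pos]
    | succ t ih =>
      rw [Finset.sum_range_succ, ih]
      simp only [hpos, next]
      split_ifs with h
      · simp only [Finset.sum_range_succ]; ring
      · have e : (pos t).2 + 1 = L (pos t).1 := by have := hr t; omega
        simp only [Finset.sum_range_succ, ← e]; simp; ring

open Filter in
/-- Every sequence of naturals can be traversed so slowly that its terms become negligible. -/
theorem exists_slow_reparametrization (L : ℕ → ℕ) :
    ∃ j : ℕ → ℕ, Tendsto j atTop atTop ∧ ∀ k, j k * L (j k) ≤ k := by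
  refine ⟨fun k => Nat.findGreatest (fun j => j * L j ≤ k) k, tendsto_atTop.2 fun N => ?_,
    fun k => Nat.findGreatest_spec (P := fun j => j * L j ≤ k) (Nat.zero_le k) (by simp)⟩
  filter_upwards [eventually_ge_atTop N, eventually_ge_atTop (N * L N)] with k h1 h2
  exact Nat.le_findGreatest h1 h2

namespace MPGame

variable {Ag St : Type} {Ac : Ag → Type}

open Filter

theorem exists_weight_bound [Finite St] (G : MPGame Ag St Ac) (i : Ag) :
    ∃ W : ℝ, ∀ s, |(G.w i s : ℝ)| ≤ W := by
  obtain ⟨W, hW⟩ := (Set.finite_range fun s => |(G.w i s : ℝ)|).bddAbove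
  exact ⟨W, fun s => hW ⟨s, rfl⟩⟩

/-- For each threshold `q`, either the other players can always hold player `i` down to `q`, or
player `i` can guarantee strictly more than `q`. -/
theorem guarantee_dichotomy [Finite St] [∀ i, Finite (Ac i)] [∀ i, Nonempty (Ac i)]
    (G : MPGame Ag St Ac) (i : Ag) (q : ℝ) :
    (∀ σ : Profile St Ac, ∃ σ' : Profile St Ac, σ' i = σ i ∧ G.pay i (G.M.run σ') ≤ q) ∨
    (∃ δ > 0, ∃ τ : Strategy St (Ac i), ∀ σ' : Profile St Ac, σ' i = τ →
      q + δ ≤ G.pay i (G.M.run σ')) := by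
  classical
  obtain ⟨W, hW⟩ := G.exists_weight_bound i
  have hR : ∀ (s : St) (a : Ac i), {t | ∃ p : ∀ j, Ac j, p i = a ∧ t = G.M.tr s p}.Nonempty :=
    fun s a => ⟨_, Function.update (fun _ => Classical.arbitrary _) i a, by simp, rfl⟩
  rcases energy_dichotomy (u := fun s => q - G.w i s) hR G.M.init with
    ⟨D, f, h₀, h⟩ | ⟨U, N, g, h₀, hN, hdrop, h⟩
  · left
    intro σ
    have : ∀ (s : St) (a : Ac i), ∃ p : ∀ j, Ac j, p i = a ∧
        (s ∈ D → G.M.tr s p ∈ D ∧ f (G.M.tr s p) ≤ f s + (q - G.w i s)) := fun s a => by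
      by_cases hs : s ∈ D
      · obtain ⟨_, ⟨p, hp, rfl⟩, h1⟩ := (h s hs).2 a
        exact ⟨p, hp, fun _ => h1⟩
      · exact ⟨Function.update (fun _ => Classical.arbitrary _) i a, by simp,
          fun h => absurd h hs⟩
    choose p hp hpD using this
    let σ' : Profile St Ac := fun j h => p (h.getLastD G.M.init) (σ i h) j
    refine ⟨σ', funext fun h => hp _ _, ?_⟩
    have inv : ∀ t, G.M.run σ' t ∈ D ∧
        ∑ v ∈ Finset.range t, (G.w i (G.M.run σ' v) : ℝ) ≤
          q * t + f G.M.init - f (G.M.run σ' t) := fun t => by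
      induction t with
      | zero => exact ⟨h₀, by simp [CGS.run, CGS.histRun]⟩
      | succ t ih =>
        have e : G.M.run σ' (t + 1) =
            G.M.tr (G.M.run σ' t) (p (G.M.run σ' t) (σ i (G.M.histRun σ' t).1)) := by
          rw [CGS.run_succ]
          simp only [σ', CGS.getLastD_histRun]
        obtain ⟨h1, h2⟩ := hpD _ (σ i (G.M.histRun σ' t).1) ih.1
        rw [← e] at h1 h2
        refine ⟨h1, ?_⟩
        rw [Finset.sum_range_succ]
        push_cast
        linarith [ih.2]
    exact meanPayoff_le (fun t => hW _) (C := f G.M.init) fun t => by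
      linarith [(inv t).2, (h _ (inv t).1).1]
  · right
    have : ∀ (j : ℕ) (s : St), ∃ a : Ac i, j < N → s ∈ U → ∀ p : ∀ j, Ac j, p i = a →
        G.M.tr s p ∈ U ∧ g j s + (q - G.w i s) ≤ g (j + 1) (G.M.tr s p) := fun j s => by
      by_cases hj : j < N ∧ s ∈ U
      · obtain ⟨a, ha⟩ := h j hj.1 s hj.2
        exact ⟨a, fun _ _ p hp => ha _ ⟨p, hp, rfl⟩⟩
      · exact ⟨Classical.arbitrary _, fun h1 h2 => absurd ⟨h1, h2⟩ hj⟩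
    choose act hact using this
    have hN' : (0 : ℝ) < N := by exact_mod_cast hN
    refine ⟨1 / N, by positivity,
      fun h => act ((h.length - 1) % N) (h.getLastD G.M.init), fun σ' hσ' => ?_⟩
    obtain ⟨C, hC⟩ := (Set.finite_range
      fun x : Fin N × St => g x.1 x.2 - g 0 G.M.init).bddAbove
    have inv : ∀ t, G.M.run σ' t ∈ U ∧
        q * t + ((t / N : ℕ) : ℝ) - (g (t % N) (G.M.run σ' t) - g 0 G.M.init) ≤
          ∑ v ∈ Finset.range t, (G.w i (G.M.run σ' v) : ℝ) := fun t => by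
      induction t with
      | zero => exact ⟨h₀, by simp [CGS.run, CGS.histRun]⟩
      | succ t ih =>
        have e : σ' i (G.M.histRun σ' t).1 = act (t % N) (G.M.run σ' t) := by
          rw [hσ']
          simp only [CGS.getLastD_histRun, CGS.length_histRun, Nat.add_sub_cancel]
        obtain ⟨h1, h2⟩ := hact (t % N) (G.M.run σ' t) (Nat.mod_lt _ hN) ih.1
          (fun j => σ' j (G.M.histRun σ' t).1) e
        rw [← CGS.run_succ] at h1 h2
        refine ⟨h1, ?_⟩
        rw [Finset.sum_range_succ]
        have h4 : (((t + 1) / N : ℕ) : ℝ) - g ((t + 1) % N) (G.M.run σ' (t + 1)) ≤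
            ((t / N : ℕ) : ℝ) - g (t % N + 1) (G.M.run σ' (t + 1)) := by
          have hlt := Nat.mod_lt t hN
          by_cases hw : t % N + 1 = N
          · have e0 : t + 1 = N * (t / N + 1) := by
              have := Nat.div_add_mod t N
              rw [Nat.mul_add, mul_one]; omega
            have e1 : (t + 1) % N = 0 := by rw [e0]; exact Nat.mul_mod_right _ _
            have e2 : (t + 1) / N = t / N + 1 := by rw [e0]; exact Nat.mul_div_cancel_left _ hN
            rw [e1, e2, hw]
            push_cast
            linarith [hdrop _ h1]
          · have e0 : t + 1 = (t % N + 1) + N * (t / N) := by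
              have := Nat.div_add_mod t N
              omega
            have hlt' : t % N + 1 < N := by omega
            have e1 : (t + 1) % N = t % N + 1 := by
              conv_lhs => rw [e0, Nat.add_mul_mod_self_left, Nat.mod_eq_of_lt hlt']
            have e2 : (t + 1) / N = t / N := by
              conv_lhs => rw [e0, Nat.add_mul_div_left _ _ hN, Nat.div_eq_of_lt hlt', zero_add]
            rw [e1, e2]
        push_cast
        linarith [ih.2]
    refine le_meanPayoff (fun t => hW _) (C := C + 1) fun t => ?_
    have h1 := (inv t).2
    have h2 : g (t % N) (G.M.run σ' t) - g 0 G.M.init ≤ C :=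
      hC ⟨(⟨t % N, Nat.mod_lt _ hN⟩, G.M.run σ' t), rfl⟩
    have h3 : 1 / (N : ℝ) * t ≤ ((t / N : ℕ) : ℝ) + 1 := by
      rw [div_mul_eq_mul_div, one_mul, div_le_iff₀ hN']
      have := (Nat.lt_div_mul_add (a := t) hN).le
      have h5 : (t : ℝ) ≤ ((t / N * N + N : ℕ) : ℝ) := by exact_mod_cast this
      push_cast at h5 ⊢
      linarith
    linarith

/-- Every player has a value: the other players can hold it down to that value against any fixed
strategy, and it can guarantee itself that value up to any positive error. -/
theorem exists_value [Finite St] [∀ i, Finite (Ac i)] [∀ i, Nonempty (Ac i)]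
    (G : MPGame Ag St Ac) (i : Ag) :
    ∃ v : ℝ,
      (∀ σ : Profile St Ac, ∃ σ' : Profile St Ac, σ' i = σ i ∧ G.pay i (G.M.run σ') ≤ v) ∧
      ∀ ε > 0, ∃ τ : Strategy St (Ac i), ∀ σ' : Profile St Ac, σ' i = τ →
        v - ε ≤ G.pay i (G.M.run σ') := by
  obtain ⟨W, hW⟩ := G.exists_weight_bound i
  let V : Set ℝ := {x | ∃ τ : Strategy St (Ac i), ∀ σ' : Profile St Ac, σ' i = τ →
    x ≤ G.pay i (G.M.run σ')}
  have hne : V.Nonempty := ⟨-W, fun _ => Classical.arbitrary _, fun _ _ =>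
    neg_le_meanPayoff fun t => hW _⟩
  have hbdd : BddAbove V := by
    classical
    refine ⟨W, ?_⟩
    rintro x ⟨τ, hτ⟩
    exact (hτ (Function.update (fun _ _ => Classical.arbitrary _) i τ) (by simp)).trans
      (meanPayoff_le_bound fun t => hW _)
  refine ⟨sSup V, ?_, fun ε hε => ?_⟩
  · rcases G.guarantee_dichotomy i (sSup V) with h | ⟨δ, hδ, hτ⟩
    · exact h
    · have : sSup V + δ ≤ sSup V := le_csSup hbdd hτ
      linarith
  · obtain ⟨x, ⟨τ, hτ⟩, hx⟩ := exists_lt_of_lt_csSup hne (sub_lt_self (sSup V) hε)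
    exact ⟨τ, fun σ' h => hx.le.trans (hτ σ' h)⟩

/-- Payoff vectors that can be approached from below by runs are dominated by a run. -/
theorem exists_isRun_le_pay [Finite Ag] [Finite St] (G : MPGame Ag St Ac) (x : Ag → ℝ)
    (h : ∀ ε > 0, ∃ ρ, G.M.IsRun ρ ∧ ∀ i, x i - ε ≤ G.pay i ρ) :
    ∃ ρ, G.M.IsRun ρ ∧ ∀ i, x i ≤ G.pay i ρ := by
  choose W hW using G.exists_weight_bound
  obtain ⟨s, hs⟩ : ∃ s, ∀ ε > 0, ∃ ρ, G.M.IsRun ρ ∧ (∀ i, x i - ε ≤ G.pay i ρ) ∧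
      ∃ᶠ t in atTop, ρ t = s := by
    by_contra! hcon
    choose ε hε hcon using hcon
    have : Nonempty St := ⟨G.M.init⟩
    obtain ⟨s₁, hs₁⟩ := Finite.exists_min ε
    obtain ⟨ρ, hρ, hpay⟩ := h (ε s₁) (hε s₁)
    have h1 : ∀ s, ∀ᶠ t in atTop, ρ t ≠ s := fun s =>
      hcon s ρ hρ fun i => by linarith [hpay i, hs₁ s]
    obtain ⟨t, ht⟩ := (eventually_all.2 h1).exists
    exact ht (ρ t) rfl
  have hcycle : ∀ n : ℕ, ∃ (c : ℕ → St) (L : ℕ), 0 < L ∧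
      (∀ r, ∃ a, c (r + 1) = G.M.tr (c r) a) ∧ c 0 = s ∧ c L = s ∧
      ∀ i, (x i - 1 / ((n : ℝ) + 1)) * L ≤ ∑ v ∈ Finset.range L, (G.w i (c v) : ℝ) := fun n => by
    have hε : (0 : ℝ) < 1 / ((n : ℝ) + 1) / 2 := by positivity
    obtain ⟨ρ, hρ, hpay, hfreq⟩ := hs _ hε
    obtain ⟨t₀, ht₀⟩ := hfreq.exists
    have h1 : ∀ᶠ L : ℕ in atTop, ∀ i, (x i - 1 / ((n : ℝ) + 1) / 2 - 1 / ((n : ℝ) + 1) / 2) * L ≤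
        ∑ v ∈ Finset.range L, (G.w i (ρ (t₀ + v)) : ℝ) :=
      eventually_all.2 fun i => eventually_le_sum_window (fun t => hW i _) (hpay i) hε t₀
    obtain ⟨t, hts, ht1, ht2⟩ := (hfreq.and_eventually
      (((tendsto_sub_atTop_nat t₀).eventually h1).and (eventually_gt_atTop t₀))).exists
    refine ⟨fun r => ρ (t₀ + r), t - t₀, by omega, fun r => hρ.2 _, ht₀, ?_, fun i => ?_⟩
    · simp only [Nat.add_sub_cancel' ht2.le, hts]
    · convert ht1 i using 2
      ring
  choose c L hL hstep hc0 hcL hsum using hcycle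
  obtain ⟨ρ₀, hρ₀, -, hfreq⟩ := hs 1 one_pos
  obtain ⟨t₁, ht₁, ht₁0⟩ := (hfreq.and_eventually (eventually_gt_atTop 0)).exists
  obtain ⟨j, hj, hjL⟩ := exists_slow_reparametrization L
  let c' : ℕ → ℕ → St := fun k => if k = 0 then ρ₀ else c (j k)
  let L' : ℕ → ℕ := fun k => if k = 0 then t₁ else L (j k)
  have hL' : ∀ k, 0 < L' k := fun k => by
    simp only [L']; split_ifs
    · exact ht₁0
    · exact hL _
  obtain ⟨ρ, K, r, hρ0, hρstep, hρ⟩ := exists_concat (fun s t => ∃ a, t = G.M.tr s a) c' L' hL'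
    (fun k r => by
      simp only [c']; split_ifs
      · exact hρ₀.2 r
      · exact hstep _ _)
    (fun k => by
      simp only [c', L', Nat.add_eq_zero_iff, one_ne_zero, and_false, if_false, hc0]
      split_ifs
      · exact ht₁
      · exact hcL _)
  have hsmall : ∀ ε > 0, ∃ C, ∀ k, (L' k : ℝ) ≤ ε * k + C := fun ε hε => by
    obtain ⟨C, hC⟩ := exists_forall_neg_le_of_eventually_nonneg
      (a := fun k => ε * k - L' k) <| by
        filter_upwards [eventually_gt_atTop 0,
          ((tendsto_natCast_atTop_atTop (R := ℝ)).comp hj).eventually_ge_atTop (1 / ε)]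
          with k hk0 hk
        have e : L' k = L (j k) := if_neg hk0.ne'
        have h1 : (j k : ℝ) * L (j k) ≤ k := by exact_mod_cast hjL k
        simp only [Function.comp, div_le_iff₀ hε] at hk
        have h2 : (0 : ℝ) ≤ L (j k) := Nat.cast_nonneg _
        rw [e]
        nlinarith [mul_le_mul_of_nonneg_left h1 hε.le, mul_le_mul_of_nonneg_right hk h2]
    exact ⟨C, fun k => by linarith [hC k]⟩
  refine ⟨ρ, ⟨by rw [hρ0]; exact hρ₀.1, hρstep⟩, fun i => ?_⟩
  refine le_meanPayoff_of_forall_sub (fun t => hW i _) fun ε hε => ?_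
  have hW0 : 0 ≤ W i := (abs_nonneg _).trans (hW i s)
  set m : ℝ := |x i| + W i with hm
  have hm0 : 0 ≤ m := by positivity
  obtain ⟨C₁, hC₁⟩ := exists_forall_neg_le_sum_of_eventually_nonneg
    (a := fun l => ∑ v ∈ Finset.range (L' l), (G.w i (c' l v) : ℝ) - (x i - ε / 2) * L' l) <| by
      filter_upwards [eventually_gt_atTop 0, (tendsto_one_div_add_atTop_nhds_zero_nat (𝕜 := ℝ)
        |>.comp hj).eventually_le_const (half_pos hε)] with k hk0 hk
      have e : L' k = L (j k) := if_neg hk0.ne'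
      have e' : c' k = c (j k) := if_neg hk0.ne'
      have h2 : (0 : ℝ) ≤ L (j k) := Nat.cast_nonneg _
      simp only [Function.comp] at hk
      rw [e, e']
      nlinarith [hsum (j k) i, mul_le_mul_of_nonneg_right hk h2]
  obtain ⟨C₂, hC₂⟩ := hsmall (ε / (2 * (m + 1))) (by positivity)
  refine ⟨C₁ + m * C₂, fun t => ?_⟩
  obtain ⟨hr, ht, hsumt⟩ := hρ t
  rw [hsumt fun s => (G.w i s : ℝ)]
  have h1 := hC₁ (K t)
  rw [Finset.sum_sub_distrib, ← Finset.mul_sum] at h1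
  have h2 : -(W i * r t) ≤ ∑ v ∈ Finset.range (r t), (G.w i (c' (K t) v) : ℝ) := by
    have := Finset.sum_le_sum (s := Finset.range (r t))
      fun v _ => (abs_le.1 (hW i (c' (K t) v))).1
    simp at this ⊢
    linarith
  have ht' : (t : ℝ) = ∑ l ∈ Finset.range (K t), (L' l : ℝ) + r t := by exact_mod_cast ht
  have hKt : (K t : ℝ) ≤ t := by
    have : K t ≤ ∑ l ∈ Finset.range (K t), L' l := by
      simpa using Finset.sum_le_sum (s := Finset.range (K t)) fun l _ => Nat.succ_le_of_lt (hL' l)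
    exact_mod_cast (by omega : K t ≤ t)
  have hrt : (r t : ℝ) ≤ ε / (2 * (m + 1)) * t + C₂ := by
    have h3 : (r t : ℝ) ≤ L' (K t) := by exact_mod_cast hr.le
    have h4 := mul_le_mul_of_nonneg_left hKt (by positivity : 0 ≤ ε / (2 * (m + 1)))
    linarith [hC₂ (K t)]
  have h5 : m * (ε / (2 * (m + 1)) * t) ≤ ε / 2 * t := by
    rw [← mul_assoc]
    refine mul_le_mul_of_nonneg_right ?_ (Nat.cast_nonneg _)
    rw [mul_div_assoc', div_le_div_iff₀ (by positivity) two_pos]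
    nlinarith
  have h6 : (x i + W i) * r t ≤ m * r t :=
    mul_le_mul_of_nonneg_right (by linarith [le_abs_self (x i)]) (Nat.cast_nonneg _)
  have h7 := mul_le_mul_of_nonneg_left hrt hm0
  have h8 : 0 ≤ ε / 2 * r t := by positivity
  have h9 : ∑ l ∈ Finset.range (K t), (L' l : ℝ) = t - r t := by linarith
  rw [h9] at h1
  nlinarith

/-- Some profile gives every player at least `v`, and no profile is better for all players
simultaneously, provided `v` can be approached from below. -/
theorem exists_weakly_pareto [Finite Ag] [Nonempty Ag] [Finite St] (G : MPGame Ag St Ac)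
    (v : Ag → ℝ)
    (h : ∀ ε > 0, ∃ σ : Profile St Ac, ∀ i, v i - ε ≤ G.pay i (G.M.run σ)) :
    ∃ σ : Profile St Ac, (∀ i, v i ≤ G.pay i (G.M.run σ)) ∧
      ∀ σ' : Profile St Ac, ∃ i, G.pay i (G.M.run σ') ≤ G.pay i (G.M.run σ) := by
  choose W hW using G.exists_weight_bound
  let Z : Set ℝ := {z | ∃ σ : Profile St Ac, ∀ i, v i + z ≤ G.pay i (G.M.run σ)}
  have hbdd : BddAbove Z := by
    obtain ⟨i⟩ := ‹Nonempty Ag›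
    refine ⟨W i - v i, ?_⟩
    rintro z ⟨σ, hσ⟩
    have : G.pay i (G.M.run σ) ≤ W i := meanPayoff_le_bound fun t => hW i _
    linarith [hσ i]
  have hmem : ∀ ε > 0, -ε ∈ Z := fun ε hε => h ε hε
  have hZ : 0 ≤ sSup Z := le_of_forall_pos_le_add fun ε hε => by
    linarith [le_csSup hbdd (hmem ε hε)]
  obtain ⟨ρ, hρ, hpay⟩ := G.exists_isRun_le_pay (fun i => v i + sSup Z) fun ε hε => by
    obtain ⟨z, ⟨σ, hσ⟩, hz⟩ := exists_lt_of_lt_csSup ⟨_, hmem 1 one_pos⟩ (sub_lt_self (sSup Z) hε)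
    exact ⟨_, G.M.isRun_run σ, fun i => by linarith [hσ i]⟩
  obtain ⟨σ, rfl⟩ := hρ.exists_run_eq
  refine ⟨σ, fun i => by linarith [hpay i], fun σ' => ?_⟩
  by_contra! hlt
  obtain ⟨i, hi⟩ := Finite.exists_min fun i => G.pay i (G.M.run σ') - v i
  have : G.pay i (G.M.run σ') - v i ≤ sSup Z :=
    le_csSup hbdd ⟨σ', fun j => by linarith [hi j]⟩
  linarith [hlt i, hpay i]

end MPGame

/-- For every mean-payoff game `G` with at most two players
(`|Ag| ≤ 2`), the core of `G` is nonempty. -/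
theorem mp_core_nonempty_of_card_le_two
    {Ag St : Type} {Ac : Ag → Type}
    [Fintype Ag] [Nonempty Ag] [Fintype St]
    [∀ i, Fintype (Ac i)] [∀ i, Nonempty (Ac i)]
    (hcard : Fintype.card Ag ≤ 2)
    (G : MPGame Ag St Ac) :
    ∃ σ : Profile St Ac, G.inCore σ := by
  choose v hv hguar using G.exists_value
  obtain ⟨σ, hσv, hσ⟩ := G.exists_weakly_pareto v fun ε hε => by
    choose τ hτ using fun i => hguar i ε hε
    exact ⟨τ, fun i => hτ i τ rfl⟩
  refine ⟨σ, fun C σC => ?_⟩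
  rintro ⟨⟨i, hi⟩, hC⟩
  by_cases huniv : C = Set.univ
  · obtain ⟨j, hj⟩ := hσ (combine C σC fun _ _ _ => Classical.arbitrary _)
    exact (hC _ j (huniv ▸ Set.mem_univ j)).not_ge hj
  · obtain rfl : C = {i} := by
      obtain ⟨k, hk⟩ := (Set.ne_univ_iff_exists_notMem C).1 huniv
      refine Set.eq_singleton_iff_unique_mem.2 ⟨hi, fun j hj => ?_⟩
      by_contra hji
      have : 2 < Fintype.card Ag := Fintype.two_lt_card_iff.2
        ⟨i, j, k, Ne.symm hji, fun h => hk (h ▸ hi), fun h => hk (h ▸ hj)⟩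
      omega
    obtain ⟨σ', hσ', hle⟩ := hv i (combine {i} σC fun _ _ _ => Classical.arbitrary _)
    have e : combine {i} σC (fun j _ => σ' j) = σ' := by
      funext j
      by_cases hj : j ∈ ({i} : Set Ag)
      · obtain rfl : j = i := hj
        simp [combine, hσ']
      · simp only [combine, dif_neg hj]
    have := hC (fun j _ => σ' j) i hi
    rw [e] at this
    linarith [hσv i]
end

section
/- There exists a three-player mean-payoff game G whose core is empty: every strategy profile admits a beneficial deviation by some coalition. -/
/-- The pair `(k, k + 1)` matched by the pointing choices `a` of three players on a circle, where
`true` points to the successor and `false` to the predecessor; the default is `2`. -/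
def matchedPair (a : Fin 3 → Bool) : Fin 3 :=
  if a 0 && !a 1 then 0 else if a 1 && !a 2 then 1 else 2

theorem matchedPair_eq (a : Fin 3 → Bool) (k : Fin 3) (h : a k = true) (h' : a (k + 1) = false) :
    matchedPair a = k := by
  revert a k
  decide

/-- The roommates game: the first move fixes a matched pair `(k, k + 1)` for ever, and then
player `k` gets `2`, player `k + 1` gets `1`, and player `k + 2` gets `0` in every round. -/
def roommatesGame : MPGame (Fin 3) (Option (Fin 3)) (fun _ => Bool) where
  M :=
    { init := none
      tr := fun s a => some (s.getD (matchedPair a)) }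
  w := fun i s => s.elim 0 fun k => 2 - ((i - k : Fin 3) : ℤ)

theorem meanPayoff_eq_of_tendsto {β : ℕ → ℝ} {c : ℝ} (h : Filter.Tendsto β Filter.atTop (nhds c)) :
    meanPayoff β = c := by
  refine Filter.Tendsto.liminf_eq ?_
  simpa only [div_eq_inv_mul] using h.cesaro

theorem roommatesGame_run_succ (σ : Profile (Option (Fin 3)) (fun _ : Fin 3 => Bool)) (t : ℕ) :
    roommatesGame.M.run σ (t + 1) = some (matchedPair fun i => σ i [none]) := by
  induction t with
  | zero => rfl
  | succ t ih =>
    have h : roommatesGame.M.run σ (t + 1 + 1) =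
        some ((roommatesGame.M.run σ (t + 1)).getD _) := rfl
    rw [h, ih, Option.getD_some]

theorem roommatesGame_pay (σ : Profile (Option (Fin 3)) (fun _ : Fin 3 => Bool)) (i : Fin 3) :
    roommatesGame.pay i (roommatesGame.M.run σ) =
      (roommatesGame.w i (some (matchedPair fun j => σ j [none])) : ℝ) := by
  refine meanPayoff_eq_of_tendsto (tendsto_const_nhds.congr' ?_)
  filter_upwards [Filter.eventually_ge_atTop 1] with t ht
  obtain ⟨t, rfl⟩ := Nat.exists_eq_add_of_le' ht
  rw [roommatesGame_run_succ]

theorem roommatesGame_w_lt (k i : Fin 3) (hi : i = k + 1 ∨ i = k + 2) :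
    roommatesGame.w i (some k) < roommatesGame.w i (some (k + 1)) := by
  revert k i
  decide

/-- There exists a three-player mean-payoff game `G` whose core
is empty: every strategy profile admits a beneficial deviation by some
coalition. -/
theorem exists_three_player_mp_game_with_empty_core :
    ∃ (St : Type) (Ac : Fin 3 → Type)
      (_ : Fintype St) (_ : ∀ i, Fintype (Ac i)) (_ : ∀ i, Nonempty (Ac i))
      (G : MPGame (Fin 3) St Ac),
      ∀ σ : Profile St Ac,
        ∃ (C : Set (Fin 3)) (σC : ∀ i ∈ C, Strategy St (Ac i)),
          G.BeneficialDeviation C σ σC := by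
  refine ⟨Option (Fin 3), fun _ => Bool, inferInstance, fun _ => inferInstance,
    fun _ => inferInstance, roommatesGame, fun σ => ?_⟩
  set k := matchedPair fun j => σ j [none] with hk
  refine ⟨{k + 1, k + 2}, fun i _ _ => decide (i = k + 1), ⟨k + 1, by simp⟩,
    fun σN i hi => ?_⟩
  have hne : k + 1 + 1 ≠ k + 1 := by simp
  have hmem : k + 1 + 1 ∈ ({k + 1, k + 2} : Set (Fin 3)) := by
    simp [add_assoc]
  rw [roommatesGame_pay, roommatesGame_pay, ← hk, matchedPair_eq _ (k + 1)]
  · exact_mod_cast roommatesGame_w_lt k i hi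
  · simp [combine]
  · simp only [combine, dif_pos hmem, hne, decide_false]
end
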